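/- Let p = 3 and q, m positive integers with |m|₃ < |q|₃ and q ≠ 0 in ℚ₃. Then the polynomial f(z) = 8m³z² - (16m³ - 24m²q + 6mq² + q³)z - 8(q-m)³ has a unique root z ∈ ℚ₃ with |z - 1|₃ < 1. -/

import Mathlib

/-- A quadratic over `ℤ_[p]` whose value at `1` is a non-unit and whose derivative at `1` is a unit
has a unique root congruent to `1`. -/
theorem PadicInt.existsUnique_quadratic_root_near_one {p : ℕ} [Fact p.Prime] (a b c : ℤ_[p])
    (hval : ‖a - b - c‖ < 1) (hderiv : ‖2 * a - b‖ = 1) :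
    ∃! z : ℤ_[p], a * z ^ 2 - b * z - c = 0 ∧ ‖z - 1‖ < 1 := by
  let F : Polynomial ℤ_[p] :=
    Polynomial.C a * Polynomial.X ^ 2 - Polynomial.C b * Polynomial.X - Polynomial.C c
  have hF (z : ℤ_[p]) : F.aeval z = a * z ^ 2 - b * z - c := by simp [F]
  have hF' : F.derivative.aeval (1 : ℤ_[p]) = 2 * a - b := by
    simp [F]
    ring
  obtain ⟨z, hz, hz1, -, huniq⟩ := hensels_lemma (F := F) (a := (1 : ℤ_[p])) (by
    rw [hF, hF', hderiv]
    simpa using hval)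
  rw [hF', hderiv] at hz1 huniq
  refine ⟨z, ⟨(hF z).symm.trans hz, hz1⟩, fun y hy => huniq y ((hF y).trans hy.1) hy.2⟩

/-- For `p = 3` and `|m|₃ < |q|₃`, the Potts quadratic has a unique root
`z ∈ ℚ₃` with `|z - 1|₃ < 1`. -/
theorem potts_quadratic_unique_root_p3 (q m : ℕ) (hq : 0 < q) (hm : 0 < m)
    (hq0 : (q : ℚ_[3]) ≠ 0)
    (hnorm : ‖(m : ℚ_[3])‖ < ‖(q : ℚ_[3])‖) :
    ∃! z : ℚ_[3],
      (8 * (m : ℚ_[3]) ^ 3 * z ^ 2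
        - (16 * (m : ℚ_[3]) ^ 3 - 24 * (m : ℚ_[3]) ^ 2 * (q : ℚ_[3])
            + 6 * (m : ℚ_[3]) * (q : ℚ_[3]) ^ 2 + (q : ℚ_[3]) ^ 3) * z
        - 8 * ((q : ℚ_[3]) - (m : ℚ_[3])) ^ 3 = 0) ∧ ‖z - 1‖ < 1 := by
  obtain ⟨t, ht⟩ : ∃ t : ℤ_[3], (t : ℚ_[3]) = m / q :=
    ⟨⟨m / q, by rw [norm_div]; exact div_le_one_of_le₀ hnorm.le (norm_nonneg _)⟩, rfl⟩
  have ht1 : ‖t‖ < 1 := by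
    rw [PadicInt.norm_def, ht, norm_div]
    exact (div_lt_one (norm_pos_iff.mpr hq0)).mpr hnorm
  have hmt : (m : ℚ_[3]) = t * q := by rw [ht, div_mul_cancel₀ _ hq0]
  have h3 : ‖(3 : ℤ_[3])‖ < 1 := by
    rw [PadicInt.norm_lt_one_iff_dvd]
    exact dvd_rfl
  have hmul (x y : ℤ_[3]) (hx : ‖x‖ < 1) : ‖x * y‖ < 1 := by
    rw [norm_mul]
    exact (mul_le_of_le_one_right (norm_nonneg _) (PadicInt.norm_le_one y)).trans_lt hx
  have hfactor (z : ℤ_[3]) :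
      8 * (m : ℚ_[3]) ^ 3 * (z : ℚ_[3]) ^ 2
        - (16 * (m : ℚ_[3]) ^ 3 - 24 * (m : ℚ_[3]) ^ 2 * (q : ℚ_[3])
            + 6 * (m : ℚ_[3]) * (q : ℚ_[3]) ^ 2 + (q : ℚ_[3]) ^ 3) * z
        - 8 * ((q : ℚ_[3]) - (m : ℚ_[3])) ^ 3 = 0 ↔
      8 * t ^ 3 * z ^ 2 - (16 * t ^ 3 - 24 * t ^ 2 + 6 * t + 1) * z - 8 * (1 - t) ^ 3 = 0 := by
    have hcoe (x : ℤ_[3]) : (x : ℚ_[3]) = PadicInt.Coe.ringHom x := rfl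
    rw [← PadicInt.coe_eq_zero, hmt, hcoe t, hcoe z, hcoe]
    simp only [map_sub, map_add, map_mul, map_pow, map_ofNat, map_one]
    rw [← mul_eq_zero_iff_left (pow_ne_zero 3 hq0)
        (b := _ - _ - 8 * (1 - PadicInt.Coe.ringHom t) ^ 3)]
    ring_nf
  obtain ⟨z, ⟨hz, hz1⟩, huniq⟩ := PadicInt.existsUnique_quadratic_root_near_one
    (8 * t ^ 3) (16 * t ^ 3 - 24 * t ^ 2 + 6 * t + 1) (8 * (1 - t) ^ 3)
    (by
      convert hmul 3 (-3 * (1 - 2 * t)) h3 using 2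
      ring)
    (by
      have h : ‖t * (24 * t - 6)‖ < ‖(-1 : ℤ_[3])‖ := by simpa using hmul t (24 * t - 6) ht1
      have := PadicInt.norm_add_eq_max_of_ne h.ne
      rw [max_eq_right h.le, norm_neg, norm_one] at this
      rw [← this]
      congr 1
      ring)
  refine ⟨z, ⟨(hfactor z).mpr hz, by exact_mod_cast hz1⟩, fun y ⟨hy, hy1⟩ => ?_⟩
  have hyint : ‖y‖ ≤ 1 := by
    have h := Padic.nonarchimedean (y - 1) 1
    rwa [sub_add_cancel, norm_one, max_eq_right hy1.le] at h
  obtain ⟨y, rfl⟩ : ∃ w : ℤ_[3], (w : ℚ_[3]) = y := ⟨⟨y, hyint⟩, rfl⟩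
  exact congrArg _ (huniq y ⟨(hfactor y).mp hy, by exact_mod_cast hy1⟩)
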